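/- Let X and Z be jointly distributed random variables on finite sets 𝒳 and 𝒵, and for probability distributions P, Q on a finite set define V(P,Q) := Σ_z |P(z) − Q(z)|. Then V(P_{ZX}, P_Z ⊗ P_X) ≤ Σ_{x,x'} P_X(x) P_X(x') V(P_{Z|X}(·|x), P_{Z|X}(·|x')), where the sum is over pairs x, x' in the support of P_X; in particular, if V(P_{Z|X}(·|x), P_{Z|X}(·|x')) ≤ 2ε for all such pairs x ≠ x', then V(P_{ZX}, P_Z ⊗ P_X) ≤ 2ε. -/

import Mathlib

open scoped BigOperators Classical

/-- Shannon entropy (base 2) of a distribution on a finite alphabet,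
with the convention `0 * logb 2 0 = 0`. -/
noncomputable def H {α : Type*} [Fintype α] (p : α → ℝ) : ℝ :=
  ∑ a, -(p a * Real.logb 2 (p a))

/-- `p` is a probability mass function on a finite alphabet. -/
def IsPMF {α : Type*} [Fintype α] (p : α → ℝ) : Prop :=
  (∀ a, 0 ≤ p a) ∧ ∑ a, p a = 1

/-- First marginal of a joint distribution. -/
noncomputable def fstM {α β : Type*} [Fintype α] [Fintype β] (p : α × β → ℝ) : α → ℝ :=
  fun a => ∑ b, p (a, b)

/-- Second marginal of a joint distribution. -/
noncomputable def sndM {α β : Type*} [Fintype α] [Fintype β] (p : α × β → ℝ) : β → ℝ :=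
  fun b => ∑ a, p (a, b)

/-- Mutual information (base 2) of a joint distribution. -/
noncomputable def MI {α β : Type*} [Fintype α] [Fintype β] (p : α × β → ℝ) : ℝ :=
  H (fstM p) + H (sndM p) - H p

/-- Marginal on the first two coordinates of a triple. -/
noncomputable def m12 {α β γ : Type*} [Fintype α] [Fintype β] [Fintype γ]
    (q : α × β × γ → ℝ) : α × β → ℝ := fun ab => ∑ c, q (ab.1, ab.2, c)

/-- Marginal on the first and third coordinates of a triple. -/
noncomputable def m13 {α β γ : Type*} [Fintype α] [Fintype β] [Fintype γ]
    (q : α × β × γ → ℝ) : α × γ → ℝ := fun ac => ∑ b, q (ac.1, b, ac.2)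

/-- Marginal on the last two coordinates of a triple. -/
noncomputable def m23 {α β γ : Type*} [Fintype α] [Fintype β] [Fintype γ]
    (q : α × β × γ → ℝ) : β × γ → ℝ := fun bc => ∑ a, q (a, bc.1, bc.2)

/-- `A → B → C` is a Markov chain for a joint distribution `q` on `α × β × γ`:
`A` and `C` are conditionally independent given the middle variable `B`. -/
def Markov {α β γ : Type*} [Fintype α] [Fintype β] [Fintype γ]
    (q : α × β × γ → ℝ) : Prop :=
  ∀ a b c, q (a, b, c) * (∑ a', ∑ c', q (a', b, c')) =
    (∑ c', q (a, b, c')) * (∑ a', q (a', b, c))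

/-- The set of achievable utilities `I(Y;Z)` over finite-valued `Z` with
`X → Y → Z` a Markov chain and privacy leakage `I(X;Z) ≤ ε`. -/
def PrivSet {α β : Type*} [Fintype α] [Fintype β] (ε : ℝ) (p : α × β → ℝ) : Set ℝ :=
  { r | ∃ (γ : Type) (_ : Fintype γ) (q : α × β × γ → ℝ),
      IsPMF q ∧ m12 q = p ∧ Markov q ∧ MI (m13 q) ≤ ε ∧ r = MI (m23 q) }

/-- The rate-privacy function `g_ε(X;Y)`. -/
noncomputable def g {α β : Type*} [Fintype α] [Fintype β] (ε : ℝ) (p : α × β → ℝ) : ℝ :=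
  sSup (PrivSet ε p)

/-- The conditional distribution `P_{X|Y}(·|y)` (the zero map if `P_Y(y) = 0`). -/
noncomputable def condX {α β : Type*} [Fintype α] [Fintype β] (p : α × β → ℝ) (y : β) :
    α → ℝ := fun x => p (x, y) / sndM p y

/-- `X` is weakly independent of `Y`: the family of conditional distributions
`P_{X|Y}(·|y)`, for `y` in the support of `P_Y`, is linearly dependent. -/
def WeaklyIndep {α β : Type*} [Fintype α] [Fintype β] (p : α × β → ℝ) : Prop :=
  ¬ LinearIndependent ℝ (fun y : {y : β // 0 < sndM p y} => condX p y.1)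

/-- `C_X(Y)`: the minimum of `H(W)` over finite-valued `W` with `X → W → Y` a
Markov chain and `H(W|Y) = 0`, i.e. `W = f(Y)` for a deterministic `f`. -/
noncomputable def Cmin {α β : Type*} [Fintype α] [Fintype β] (p : α × β → ℝ) : ℝ :=
  sInf { r | ∃ (γ : Type) (_ : Fintype γ) (f : β → γ),
      Markov (fun xwy : α × γ × β => if f xwy.2.2 = xwy.2.1 then p (xwy.1, xwy.2.2) else 0) ∧
      r = H (fun w : γ => ∑ y, if f y = w then sndM p y else 0) }

/-- Common entropy `G(X;Y)`: the minimum of `H(W)` over finite-valued `W`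
with `X → W → Y` a Markov chain. -/
noncomputable def Gmin {α β : Type*} [Fintype α] [Fintype β] (p : α × β → ℝ) : ℝ :=
  sInf { r | ∃ (γ : Type) (_ : Fintype γ) (q : α × γ × β → ℝ),
      IsPMF q ∧ m13 q = p ∧ Markov q ∧ r = H (fstM (m23 q)) }

/-- Entropy of the push-forward of the distribution `pY` under the map `f`. -/
noncomputable def Hpush {β S : Type*} [Fintype β] (pY : β → ℝ) (f : β → S) : ℝ :=
  letI := Classical.decEq S
  ∑ t ∈ Finset.image f Finset.univ,
    -((∑ y ∈ Finset.univ.filter fun y => f y = t, pY y) *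
      Real.logb 2 (∑ y ∈ Finset.univ.filter fun y => f y = t, pY y))

/-- A joint distribution vanishes wherever its second marginal is not positive. -/
lemma IsPMF.eq_zero_of_not_sndM_pos {α β : Type*} [Fintype α] [Fintype β] {p : α × β → ℝ}
    (hp : IsPMF p) {b : β} (hb : ¬ 0 < sndM p b) (a : α) : p (a, b) = 0 :=
  le_antisymm ((Finset.single_le_sum (f := fun a => p (a, b)) (fun i _ => hp.1 (i, b))
    (Finset.mem_univ a)).trans (not_lt.mp hb)) (hp.1 _)

/-- The second marginal vanishes wherever it is not positive. -/
lemma IsPMF.sndM_eq_zero {α β : Type*} [Fintype α] [Fintype β] {p : α × β → ℝ}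
    (hp : IsPMF p) {b : β} (hb : ¬ 0 < sndM p b) : sndM p b = 0 :=
  Finset.sum_eq_zero fun a _ => hp.eq_zero_of_not_sndM_pos hb a

/-- The second marginal sums to one over its support. -/
lemma IsPMF.sum_sndM_support {α β : Type*} [Fintype α] [Fintype β] {p : α × β → ℝ}
    (hp : IsPMF p) : ∑ b ∈ Finset.univ.filter (fun b => 0 < sndM p b), sndM p b = 1 := by
  rw [Finset.sum_filter_of_ne fun b _ hb => not_not.mp (mt hp.sndM_eq_zero hb), ← hp.2,
    Fintype.sum_prod_type_right]
  rfl

/-- The first marginal may be computed by summing over the support of the second. -/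
lemma IsPMF.sum_support_eq_fstM {α β : Type*} [Fintype α] [Fintype β] {p : α × β → ℝ}
    (hp : IsPMF p) (a : α) :
    ∑ b ∈ Finset.univ.filter (fun b => 0 < sndM p b), p (a, b) = fstM p a :=
  Finset.sum_filter_of_ne fun _ _ hb =>
    not_not.mp (mt (fun h => hp.eq_zero_of_not_sndM_pos h a) hb)

/-- The deviation of a joint distribution from the product of its marginals is an average of
differences of conditional distributions. -/
lemma IsPMF.sub_mul_eq_sum {α β : Type*} [Fintype α] [Fintype β] {p : α × β → ℝ}
    (hp : IsPMF p) (a : α) {b : β} (hb : 0 < sndM p b) :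
    p (a, b) - fstM p a * sndM p b =
      ∑ b' ∈ Finset.univ.filter (fun b' => 0 < sndM p b'),
        sndM p b * sndM p b' * (p (a, b) / sndM p b - p (a, b') / sndM p b') := by
  have h : ∀ b' ∈ Finset.univ.filter (fun b' => 0 < sndM p b'),
      sndM p b * sndM p b' * (p (a, b) / sndM p b - p (a, b') / sndM p b') =
        p (a, b) * sndM p b' - p (a, b') * sndM p b := by
    intro b' hb'
    have hb'' := (Finset.mem_filter.mp hb').2
    field_simp
  rw [Finset.sum_congr rfl h, Finset.sum_sub_distrib, ← Finset.mul_sum, ← Finset.sum_mul,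
    hp.sum_sndM_support, hp.sum_support_eq_fstM, mul_one]

/-- The distance of a joint distribution from the product of its marginals is at most the
average distance between its conditional distributions. -/
lemma IsPMF.sum_abs_sub_mul_le {α β : Type*} [Fintype α] [Fintype β] {p : α × β → ℝ}
    (hp : IsPMF p) :
    (∑ a, ∑ b, |p (a, b) - fstM p a * sndM p b|) ≤
      ∑ b ∈ Finset.univ.filter (fun b => 0 < sndM p b),
        ∑ b' ∈ Finset.univ.filter (fun b' => 0 < sndM p b'),
          sndM p b * sndM p b' *
            ∑ a, |p (a, b) / sndM p b - p (a, b') / sndM p b'| := by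
  rw [Finset.sum_comm, ← Finset.sum_filter_of_ne (p := fun b => 0 < sndM p b)]
  · refine Finset.sum_le_sum fun b hb => ?_
    have hb := (Finset.mem_filter.mp hb).2
    simp_rw [Finset.mul_sum]
    rw [Finset.sum_comm]
    refine Finset.sum_le_sum fun a _ => ?_
    rw [hp.sub_mul_eq_sum a hb]
    refine (Finset.abs_sum_le_sum_abs _ _).trans (Finset.sum_le_sum fun b' hb' => ?_)
    have hb' := (Finset.mem_filter.mp hb').2
    rw [abs_mul, abs_of_pos (mul_pos hb hb')]
  · intro b _ h
    by_contra hb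
    exact h (Finset.sum_eq_zero fun a _ => by
      simp [hp.eq_zero_of_not_sndM_pos hb a, hp.sndM_eq_zero hb])

/-- For jointly distributed `(Z,X)` on finite sets,
`V(P_{ZX}, P_Z ⊗ P_X) ≤ Σ_{x,x'} P_X(x) P_X(x') V(P_{Z|X}(·|x), P_{Z|X}(·|x'))`
(the sum over pairs in the support of `P_X`); in particular, if
`V(P_{Z|X}(·|x), P_{Z|X}(·|x')) ≤ 2ε` for all distinct such pairs, then
`V(P_{ZX}, P_Z ⊗ P_X) ≤ 2ε`. -/
theorem stmt18 {𝒵 𝒳 : Type*} [Fintype 𝒵] [Fintype 𝒳] (r : 𝒵 × 𝒳 → ℝ)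
    (hr : IsPMF r) (ε : ℝ) (hε : 0 ≤ ε) :
    ((∑ z, ∑ x, |r (z, x) - fstM r z * sndM r x|) ≤
      ∑ x ∈ Finset.univ.filter (fun x => 0 < sndM r x),
        ∑ x' ∈ Finset.univ.filter (fun x' => 0 < sndM r x'),
          sndM r x * sndM r x' *
            ∑ z, |r (z, x) / sndM r x - r (z, x') / sndM r x'|) ∧
    ((∀ x x', 0 < sndM r x → 0 < sndM r x' → x ≠ x' →
        (∑ z, |r (z, x) / sndM r x - r (z, x') / sndM r x'|) ≤ 2 * ε) →
      (∑ z, ∑ x, |r (z, x) - fstM r z * sndM r x|) ≤ 2 * ε) := by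
  refine ⟨hr.sum_abs_sub_mul_le, fun h => hr.sum_abs_sub_mul_le.trans ?_⟩
  calc _ ≤ ∑ x ∈ Finset.univ.filter (fun x => 0 < sndM r x),
        ∑ x' ∈ Finset.univ.filter (fun x' => 0 < sndM r x'),
          sndM r x * sndM r x' * (2 * ε) := by
        refine Finset.sum_le_sum fun x hx => Finset.sum_le_sum fun x' hx' => ?_
        have hx := (Finset.mem_filter.mp hx).2
        have hx' := (Finset.mem_filter.mp hx').2
        refine mul_le_mul_of_nonneg_left ?_ (mul_pos hx hx').le
        by_cases hxx' : x = x'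
        · subst hxx'
          simpa using hε
        · exact h x x' hx hx' hxx'
    _ = 2 * ε := by
        simp_rw [← Finset.sum_mul, ← Finset.mul_sum, hr.sum_sndM_support, mul_one,
          hr.sum_sndM_support, one_mul]
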